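/- Let A₁, A₂, Φ : ℝ² → ℝ³ be continuously differentiable and let A₀ : ℝ² → ℝ³ be a twice continuously differentiable solution on ℝ² of the static non-Abelian Gauss law ΔA₀ + ∂_i(A_i × A₀) + A_i × ∂_iA₀ + A_i × (A_i × A₀) − Φ × (A₀ × Φ) = 0 (sum over i = 1,2), whose electric energy E(A₀) = ∫_{ℝ²} [ ½ Σ_i |∂_iA₀ + A_i × A₀|² + ½ |A₀ × Φ|² ] dx is finite. Then E(A₀) = 0; in particular ∂_iA₀ + A_i × A₀ ≡ 0 for i = 1,2, A₀ × Φ ≡ 0, and |A₀| is constant on ℝ². -/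

import Mathlib

/-!
The non-Abelian (SU(2)) Julia–Zee theorem, energy part: a finite-electric-energy
solution A₀ of the static non-Abelian Gauss law has E(A₀) = 0; in particular
F_{i0} = ∂ᵢA₀ + Aᵢ × A₀ ≡ 0, A₀ × Φ ≡ 0, and |A₀| is constant.
-/

open MeasureTheory

noncomputable section

/-- The plane ℝ². -/
abbrev Plane : Type := EuclideanSpace ℝ (Fin 2)

/-- Euclidean ℝ³. -/
abbrev V3 : Type := EuclideanSpace ℝ (Fin 3)

/-- The vector cross product on ℝ³. -/
def cross (a b : V3) : V3 :=
  (WithLp.equiv 2 (Fin 3 → ℝ)).symm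
    ![a 1 * b 2 - a 2 * b 1, a 2 * b 0 - a 0 * b 2, a 0 * b 1 - a 1 * b 0]

/-- Partial derivative of an ℝ³-valued field in the `i`-th coordinate direction. -/
def pd (i : Fin 2) (f : Plane → V3) (x : Plane) : V3 :=
  fderiv ℝ f x (EuclideanSpace.single i 1)

/-- The (componentwise) Laplacian on ℝ². -/
def lap (f : Plane → V3) (x : Plane) : V3 :=
  pd 0 (pd 0 f) x + pd 1 (pd 1 f) x

lemma cross_add (a b c : V3) : cross a (b + c) = cross a b + cross a c := by
  ext i; fin_cases i <;> simp [cross] <;> ring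

lemma inner_cross_swap (a b c : V3) : inner ℝ b (cross a c) = -inner ℝ (cross a b) c := by
  simp [cross, PiLp.inner_apply, Fin.sum_univ_three]; ring

lemma inner_cross_cross (u p : V3) :
    inner ℝ u (cross p (cross u p)) = ‖cross u p‖ ^ 2 := by
  simp [cross, PiLp.inner_apply, EuclideanSpace.norm_sq_eq, Fin.sum_univ_three]; ring

lemma inner_cross_self (a u : V3) : inner ℝ u (cross a u) = 0 := by
  simp [cross, PiLp.inner_apply, Fin.sum_univ_three]; ring

lemma ContDiff.cross {f g : Plane → V3} (hf : ContDiff ℝ 1 f) (hg : ContDiff ℝ 1 g) :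
    ContDiff ℝ 1 (fun x => cross (f x) (g x)) := by
  rw [contDiff_euclidean] at hf hg ⊢
  have := hf 0; have := hf 1; have := hf 2; have := hg 0; have := hg 1; have := hg 2
  intro i
  fin_cases i <;> simp [_root_.cross] <;> fun_prop

lemma ContDiff.pd {f : Plane → V3} (hf : ContDiff ℝ 2 f) (i : Fin 2) :
    ContDiff ℝ 1 (pd i f) :=
  (hf.fderiv_right (m := 1) (by norm_num)).clm_apply contDiff_const

lemma fderiv_inner_div_sqrt {u F : Plane → V3} (hu : ContDiff ℝ 1 u) (hF : ContDiff ℝ 1 F)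
    (x e : Plane) (hp : inner ℝ (u x) (fderiv ℝ u x e) = inner ℝ (u x) (F x)) :
    fderiv ℝ (fun y => inner ℝ (u y) (F y) / √(1 + ‖u y‖ ^ 2)) x e =
      (inner ℝ (u x) (fderiv ℝ F x e) + inner ℝ (fderiv ℝ u x e) (F x)
        - inner ℝ (u x) (F x) ^ 2 / (1 + ‖u x‖ ^ 2)) / √(1 + ‖u x‖ ^ 2) := by
  have hpos : 0 < 1 + ‖u x‖ ^ 2 := by positivity
  have hs : 0 < √(1 + ‖u x‖ ^ 2) := Real.sqrt_pos.2 hpos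
  have hud := ((hu.differentiable one_ne_zero) x).hasFDerivAt
  have hFd := ((hF.differentiable one_ne_zero) x).hasFDerivAt
  have h1 := hud.inner ℝ hFd
  have h2 := (hud.norm_sq.const_add 1).sqrt hpos.ne'
  have h3 := h1.mul ((hasDerivAt_inv hs.ne').comp_hasFDerivAt x h2)
  simp only [div_eq_mul_inv (inner ℝ (u _) (F _))]
  have h4 := h3.fderiv
  simp only [Function.comp_def] at h4
  erw [h4]
  simp [hp]
  have := Real.sq_sqrt hpos.le
  field_simp
  rw [this]
  ring

open Filter Topology in
theorem divergence_eq_zero_of_nonneg_of_sq_integrable {X : Fin 2 → Plane → ℝ}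
    (hX : ∀ i, ContDiff ℝ 1 (X i)) (hL : ∀ i, Integrable (fun x => X i x ^ 2))
    (hdiv : ∀ x, 0 ≤ ∑ i, fderiv ℝ (X i) x (EuclideanSpace.single i 1)) (x : Plane) :
    ∑ i, fderiv ℝ (X i) x (EuclideanSpace.single i 1) = 0 := by
  let e : Fin 2 → Plane := fun i => EuclideanSpace.single i 1
  let d : Plane → ℝ := fun x => ∑ i, fderiv ℝ (X i) x (e i)
  have hd0 : ∀ x, 0 ≤ d x := hdiv
  change d x = 0
  have hXc : ∀ i, Continuous fun x => fderiv ℝ (X i) x (e i) := fun i =>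
    ((hX i).continuous_fderiv one_ne_zero).clm_apply continuous_const
  have hdc : Continuous d := continuous_finsetSum _ fun i _ => hXc i
  let b : ContDiffBump (0 : Plane) := ⟨1, 2, one_pos, one_lt_two⟩
  have hb : ContDiff ℝ 1 b := b.contDiff
  -- rescaled cutoff functions
  let η : ℝ → Plane → ℝ := fun R y => b (R⁻¹ • y)
  have hη : ∀ R, ContDiff ℝ 1 (η R) := fun R => hb.comp (contDiff_const_smul _)
  have hηs : ∀ R, 0 < R → HasCompactSupport (η R) := fun R hR =>
    b.hasCompactSupport.comp_homeomorph (Homeomorph.smulOfNeZero R⁻¹ (inv_ne_zero hR.ne'))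
  have hη1 : ∀ R, 0 < R → ∀ y, ‖y‖ ≤ R → η R y = 1 := by
    intro R hR y hy
    apply b.one_of_mem_closedBall
    simp only [mem_closedBall_zero_iff, norm_smul, norm_inv, Real.norm_eq_abs, abs_of_pos hR, b]
    rw [inv_mul_le_iff₀ hR]; simpa using hy
  have hη0 : ∀ R, 0 < R → ∀ y, 2 * R ≤ ‖y‖ → η R y = 0 := by
    intro R hR y hy
    apply b.zero_of_le_dist
    simp only [dist_zero_right, norm_smul, norm_inv, Real.norm_eq_abs, abs_of_pos hR, b]
    rw [le_inv_mul_iff₀ hR]; linarith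
  let g : Fin 2 → Plane → ℝ := fun i y => fderiv ℝ b y (e i)
  have hgc : ∀ i, Continuous (g i) := fun i =>
    (hb.continuous_fderiv one_ne_zero).clm_apply continuous_const
  have hgs : ∀ i, HasCompactSupport (g i) := fun i => b.hasCompactSupport.fderiv_apply ℝ (e i)
  have hηd : ∀ R i y, fderiv ℝ (η R) y (e i) = R⁻¹ * g i (R⁻¹ • y) := by
    intro R i y
    have := fderiv_comp_smul (𝕜 := ℝ) (f := b) (x := y) R⁻¹
    simp only [η, g]
    rw [this]; simp
  have hηd0 : ∀ R, 0 < R → ∀ i y, ‖y‖ < R → fderiv ℝ (η R) y (e i) = 0 := by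
    intro R hR i y hy
    have : η R =ᶠ[𝓝 y] fun _ => 1 := by
      filter_upwards [(isOpen_lt continuous_norm continuous_const).mem_nhds hy] with z hz
      exact hη1 R hR z (le_of_lt hz)
    rw [this.fderiv_eq]; simp
  have hηdc : ∀ R i, Continuous fun y => fderiv ℝ (η R) y (e i) := fun R i =>
    ((hη R).continuous_fderiv one_ne_zero).clm_apply continuous_const
  have hηds : ∀ R, 0 < R → ∀ i, HasCompactSupport fun y => fderiv ℝ (η R) y (e i) :=
    fun R hR i => (hηs R hR).fderiv_apply ℝ (e i)
  let K : ℝ := ∑ i, ∫ y, g i y ^ 2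
  -- the Dirichlet energy of the cutoffs is scale invariant in two dimensions
  have hK : ∀ R, 0 < R → ∀ i, ∫ y, (fderiv ℝ (η R) y (e i)) ^ 2 = ∫ y, g i y ^ 2 := by
    intro R hR i
    simp only [hηd, mul_pow]
    rw [integral_const_mul, Measure.integral_comp_smul volume (fun y => g i y ^ 2)]
    simp only [finrank_euclideanSpace, Fintype.card_fin, smul_eq_mul]
    rw [abs_of_pos (by positivity)]
    field_simp
  let T : ℝ → ℝ := fun R => ∑ i, ∫ y in {y | R ≤ ‖y‖}, X i y ^ 2
  have hT : Tendsto T atTop (𝓝 0) := by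
    have : ∀ i, Tendsto (fun R : ℝ => ∫ y in {y | R ≤ ‖y‖}, X i y ^ 2) atTop (𝓝 0) := by
      intro i
      have h := tendsto_setIntegral_of_antitone (μ := volume) (f := fun y => X i y ^ 2)
        (s := fun R : ℝ => {y : Plane | R ≤ ‖y‖})
        (fun R => (isClosed_le continuous_const continuous_norm).measurableSet)
        (fun R S hRS y hy => le_trans hRS hy) ⟨0, (hL i).integrableOn⟩
      have h0 : (⋂ R : ℝ, {y : Plane | R ≤ ‖y‖}) = ∅ := by
        ext y
        simp only [Set.mem_iInter, Set.mem_ofPred_eq, Set.mem_empty_iff_false, iff_false, not_forall,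
          not_le]
        exact exists_gt _
      simpa [h0] using h
    simpa [T] using tendsto_finsetSum Finset.univ fun i _ => this i
  have hkey : ∀ R, 0 < R → ∀ δ, 0 < δ → ∫ y, η R y * d y ≤ δ * K + δ⁻¹ * T R := by
    intro R hR δ hδ
    have hi : ∀ i, Integrable fun y => η R y * fderiv ℝ (X i) y (e i) := fun i =>
      ((hη R).continuous.mul (hXc i)).integrable_of_hasCompactSupport (hηs R hR).mul_right
    have hi' : ∀ i, Integrable fun y => fderiv ℝ (η R) y (e i) * X i y := fun i =>
      ((hηdc R i).mul (hX i).continuous).integrable_of_hasCompactSupport (hηds R hR i).mul_right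
    have h1 : ∫ y, η R y * d y = ∑ i, ∫ y, η R y * fderiv ℝ (X i) y (e i) := by
      rw [← integral_finsetSum _ fun i _ => hi i]
      simp only [d, Finset.mul_sum]
    rw [h1, Finset.mul_sum, Finset.mul_sum, ← Finset.sum_add_distrib]
    refine Finset.sum_le_sum fun i _ => ?_
    rw [integral_mul_fderiv_eq_neg_fderiv_mul_of_integrable (hi' i) (hi i)
      (((hη R).continuous.mul (hX i).continuous).integrable_of_hasCompactSupport
        (hηs R hR).mul_right) (fun y _ => (hη R).differentiable one_ne_zero y)
      (fun y _ => (hX i).differentiable one_ne_zero y), ← integral_neg, ← hK R hR i]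
    have hm : MeasurableSet {y : Plane | R ≤ ‖y‖} :=
      (isClosed_le continuous_const continuous_norm).measurableSet
    have hint1 : Integrable fun y => (fderiv ℝ (η R) y (e i)) ^ 2 := by
      simp only [sq]
      exact ((hηdc R i).mul (hηdc R i)).integrable_of_hasCompactSupport (hηds R hR i).mul_right
    rw [← integral_indicator hm, ← integral_const_mul, ← integral_const_mul,
      ← integral_add (hint1.const_mul δ) (((hL i).indicator hm).const_mul _)]
    refine integral_mono (hi' i).neg
      ((hint1.const_mul δ).add (((hL i).indicator hm).const_mul _)) fun y => ?_
    by_cases hy : R ≤ ‖y‖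
    · rw [Set.indicator_of_mem (by exact hy)]
      have := sq_nonneg (δ * fderiv ℝ (η R) y (e i) + X i y)
      have h2 := sq_nonneg (δ * fderiv ℝ (η R) y (e i))
      have h3 := sq_nonneg (X i y)
      rw [← mul_le_mul_iff_right₀ hδ]
      field_simp
      nlinarith
    · rw [Set.indicator_of_notMem (by exact hy), hηd0 R hR i y (not_le.1 hy)]
      simp
  by_contra hx
  let R₀ : ℝ := ‖x‖ + 1
  have hR₀ : 0 < R₀ := by positivity
  have hint : ∀ R, 0 < R → Integrable fun y => η R y * d y := fun R hR =>
    ((hη R).continuous.mul hdc).integrable_of_hasCompactSupport (hηs R hR).mul_right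
  have hpos : 0 < ∫ y, η R₀ y * d y := by
    refine ((hη R₀).continuous.mul hdc).integral_pos_of_hasCompactSupport_nonneg_nonzero
      (hηs R₀ hR₀).mul_right (fun y => mul_nonneg b.nonneg (hd0 y)) (x := x) ?_
    rw [hη1 R₀ hR₀ x (by simp [R₀]), one_mul]
    exact hx
  have hle : ∀ R, 2 * R₀ ≤ R → ∫ y, η R₀ y * d y ≤ ∫ y, η R y * d y := by
    intro R hR
    refine integral_mono (hint _ hR₀) (hint _ (by linarith)) fun y => ?_
    refine mul_le_mul_of_nonneg_right ?_ (hd0 y)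
    by_cases hy : ‖y‖ ≤ R
    · rw [hη1 R (by linarith) y hy]
      exact b.le_one
    · rw [hη0 R₀ hR₀ y (by linarith)]
      exact b.nonneg
  have hbound : ∀ δ, 0 < δ → ∫ y, η R₀ y * d y ≤ δ * K := by
    intro δ hδ
    have hlim : Tendsto (fun R => δ * K + δ⁻¹ * T R) atTop (𝓝 (δ * K)) := by
      simpa using (hT.const_mul δ⁻¹).const_add (δ * K)
    refine ge_of_tendsto hlim ?_
    filter_upwards [eventually_ge_atTop (2 * R₀)] with R hR
    exact (hle R hR).trans (hkey R (by linarith) δ hδ)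
  have hlim : Tendsto (fun δ : ℝ => δ * K) (𝓝[>] 0) (𝓝 0) := by
    have : Tendsto (fun δ : ℝ => δ * K) (𝓝 0) (𝓝 (0 * K)) :=
      (continuous_mul_const K).tendsto 0
    simpa using this.mono_left nhdsWithin_le_nhds
  exact hpos.not_ge (ge_of_tendsto hlim (eventually_mem_nhdsWithin.mono fun δ hδ => hbound δ hδ))

theorem nonabelian_julia_zee_energy
    (A : Fin 2 → Plane → V3) (Φ A₀ : Plane → V3)
    (hA : ∀ i, ContDiff ℝ 1 (A i)) (hΦ : ContDiff ℝ 1 Φ) (hA₀ : ContDiff ℝ 2 A₀)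
    -- the static non-Abelian Gauss law
    (heq : ∀ x, lap A₀ x
        + ∑ i, (pd i (fun y => cross (A i y) (A₀ y)) x
            + cross (A i x) (pd i A₀ x)
            + cross (A i x) (cross (A i x) (A₀ x)))
        - cross (Φ x) (cross (A₀ x) (Φ x)) = 0)
    -- finite electric energy E(A₀)
    (hfin : Integrable (fun x =>
        (1 / 2) * ∑ i, ‖pd i A₀ x + cross (A i x) (A₀ x)‖ ^ 2
        + (1 / 2) * ‖cross (A₀ x) (Φ x)‖ ^ 2)) :
    (∫ x, ((1 / 2) * ∑ i, ‖pd i A₀ x + cross (A i x) (A₀ x)‖ ^ 2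
        + (1 / 2) * ‖cross (A₀ x) (Φ x)‖ ^ 2)) = 0 ∧
    (∀ i x, pd i A₀ x + cross (A i x) (A₀ x) = 0) ∧
    (∀ x, cross (A₀ x) (Φ x) = 0) ∧
    (∃ c : ℝ, ∀ x, ‖A₀ x‖ = c) := by
  let F : Fin 2 → Plane → V3 := fun i y => pd i A₀ y + cross (A i y) (A₀ y)
  have hu : ContDiff ℝ 1 A₀ := hA₀.of_le (by norm_num)
  have hcr : ∀ i, ContDiff ℝ 1 fun y => cross (A i y) (A₀ y) := fun i => (hA i).cross hu
  have hF : ∀ i, ContDiff ℝ 1 (F i) := fun i => (hA₀.pd i).add (hcr i)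
  have hpd : ∀ i x, pd i (F i) x
      = pd i (pd i A₀) x + pd i (fun y => cross (A i y) (A₀ y)) x := by
    intro i x
    have := fderiv_fun_add ((hA₀.pd i).differentiable one_ne_zero x)
      ((hcr i).differentiable one_ne_zero x)
    simp only [pd, F] at this ⊢
    rw [this]
    rfl
  have hgauss : ∀ x, ∑ i, (pd i (F i) x + cross (A i x) (F i x))
      = cross (Φ x) (cross (A₀ x) (Φ x)) := by
    intro x
    rw [← sub_eq_zero, ← heq x]
    simp only [hpd, lap, F, cross_add, Fin.sum_univ_two]
    abel
  have hp : ∀ i x, inner ℝ (A₀ x) (pd i A₀ x) = inner ℝ (A₀ x) (F i x) := by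
    intro i x
    simp only [F, inner_add_right, inner_cross_self, add_zero]
  have hpF : ∀ i x, inner ℝ (A₀ x) (pd i (F i) x) + inner ℝ (pd i A₀ x) (F i x)
      = ‖F i x‖ ^ 2 + inner ℝ (A₀ x) (pd i (F i) x + cross (A i x) (F i x)) := by
    intro i x
    have h : pd i A₀ x = F i x - cross (A i x) (A₀ x) := by simp [F]
    rw [h, inner_sub_left, real_inner_self_eq_norm_sq, inner_add_right (A₀ x),
      inner_cross_swap (A i x) (A₀ x)]
    ring
  let X : Fin 2 → Plane → ℝ := fun i y => inner ℝ (A₀ y) (F i y) / √(1 + ‖A₀ y‖ ^ 2)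
  have hpos : ∀ x, 0 < 1 + ‖A₀ x‖ ^ 2 := fun x => by positivity
  have hs : ∀ x, 0 < √(1 + ‖A₀ x‖ ^ 2) := fun x => Real.sqrt_pos.2 (hpos x)
  have hX : ∀ i, ContDiff ℝ 1 (X i) := fun i =>
    (hu.inner ℝ (hF i)).div ((contDiff_const.add (hu.norm_sq ℝ)).sqrt fun x => (hpos x).ne')
      fun x => (hs x).ne'
  have hCS : ∀ i x, inner ℝ (A₀ x) (F i x) ^ 2 ≤ ‖A₀ x‖ ^ 2 * ‖F i x‖ ^ 2 := by
    intro i x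
    rw [← mul_pow, sq_le_sq, abs_of_nonneg (mul_nonneg (norm_nonneg _) (norm_nonneg _))]
    exact abs_real_inner_le_norm _ _
  have hL : ∀ i, Integrable fun x => X i x ^ 2 := by
    intro i
    refine (hfin.const_mul 2).mono' ((hX i).continuous.pow 2).aestronglyMeasurable
      (.of_forall fun x => ?_)
    have h1 : X i x ^ 2 ≤ ‖F i x‖ ^ 2 := by
      simp only [X]
      rw [div_pow, Real.sq_sqrt (hpos x).le, div_le_iff₀ (hpos x)]
      nlinarith [hCS i x, sq_nonneg ‖F i x‖]
    have h2 : ‖F i x‖ ^ 2 ≤ ∑ j, ‖F j x‖ ^ 2 :=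
      Finset.single_le_sum (f := fun j => ‖F j x‖ ^ 2) (fun j _ => sq_nonneg _)
        (Finset.mem_univ i)
    rw [Real.norm_of_nonneg (sq_nonneg _)]
    have h3 := sq_nonneg ‖cross (A₀ x) (Φ x)‖
    change _ ≤ 2 * ((1 / 2) * ∑ j, ‖F j x‖ ^ 2 + _)
    linarith
  have hdiv : ∀ x, ∑ i, fderiv ℝ (X i) x (EuclideanSpace.single i 1)
      = ((∑ i, (‖F i x‖ ^ 2 - inner ℝ (A₀ x) (F i x) ^ 2 / (1 + ‖A₀ x‖ ^ 2)))
        + ‖cross (A₀ x) (Φ x)‖ ^ 2) / √(1 + ‖A₀ x‖ ^ 2) := by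
    intro x
    rw [← inner_cross_cross, ← hgauss x, inner_sum, ← Finset.sum_add_distrib, Finset.sum_div]
    refine Finset.sum_congr rfl fun i _ => ?_
    rw [fderiv_inner_div_sqrt hu (hF i) x _ (hp i x)]
    have := hpF i x
    simp only [pd] at this ⊢
    rw [this]
    ring
  have hlow : ∀ i x, ‖F i x‖ ^ 2 / (1 + ‖A₀ x‖ ^ 2)
      ≤ ‖F i x‖ ^ 2 - inner ℝ (A₀ x) (F i x) ^ 2 / (1 + ‖A₀ x‖ ^ 2) := by
    intro i x
    rw [le_sub_iff_add_le, ← add_div, div_le_iff₀ (hpos x)]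
    linarith [hCS i x]
  have hlow0 : ∀ i x, 0 ≤ ‖F i x‖ ^ 2 / (1 + ‖A₀ x‖ ^ 2) := fun i x => by positivity
  have hterm : ∀ i x,
      0 ≤ ‖F i x‖ ^ 2 - inner ℝ (A₀ x) (F i x) ^ 2 / (1 + ‖A₀ x‖ ^ 2) := fun i x =>
    (hlow0 i x).trans (hlow i x)
  have hsum : ∀ x,
      0 ≤ ∑ i, (‖F i x‖ ^ 2 - inner ℝ (A₀ x) (F i x) ^ 2 / (1 + ‖A₀ x‖ ^ 2)) := fun x =>
    Finset.sum_nonneg fun i _ => hterm i x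
  have hzero : ∀ x, (∑ i, (‖F i x‖ ^ 2 - inner ℝ (A₀ x) (F i x) ^ 2 / (1 + ‖A₀ x‖ ^ 2)))
      + ‖cross (A₀ x) (Φ x)‖ ^ 2 = 0 := by
    intro x
    have h := divergence_eq_zero_of_nonneg_of_sq_integrable hX hL (fun y => by
      rw [hdiv y]
      exact div_nonneg (add_nonneg (hsum y) (sq_nonneg _)) (hs y).le) x
    rw [hdiv x, div_eq_zero_iff] at h
    exact h.resolve_right (hs x).ne'
  have hF0 : ∀ i x, F i x = 0 := by
    intro i x
    have h1 : ∑ i, (‖F i x‖ ^ 2 - inner ℝ (A₀ x) (F i x) ^ 2 / (1 + ‖A₀ x‖ ^ 2)) = 0 := by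
      linarith [hzero x, hsum x, sq_nonneg ‖cross (A₀ x) (Φ x)‖]
    have h2 := (Finset.sum_eq_zero_iff_of_nonneg fun i _ => hterm i x).1 h1 i (Finset.mem_univ i)
    have h3 : ‖F i x‖ ^ 2 / (1 + ‖A₀ x‖ ^ 2) = 0 := le_antisymm (h2 ▸ hlow i x) (hlow0 i x)
    simpa [(hpos x).ne'] using h3
  have hq0 : ∀ x, cross (A₀ x) (Φ x) = 0 := by
    intro x
    have h : ‖cross (A₀ x) (Φ x)‖ ^ 2 = 0 := by
      linarith [hzero x, hsum x, sq_nonneg ‖cross (A₀ x) (Φ x)‖]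
    simpa using h
  refine ⟨?_, hF0, hq0, ‖A₀ 0‖, fun x => ?_⟩
  · have h : ∀ i x, pd i A₀ x + cross (A i x) (A₀ x) = 0 := hF0
    simp [h, hq0]
  · have hd : Differentiable ℝ A₀ := hu.differentiable one_ne_zero
    have h : ∀ y, fderiv ℝ (fun z => ‖A₀ z‖ ^ 2) y = 0 := by
      intro y
      rw [(hd y).hasFDerivAt.norm_sq.fderiv]
      refine ContinuousLinearMap.coe_injective
        ((EuclideanSpace.basisFun (Fin 2) ℝ).toBasis.ext fun i => ?_)
      have := hp i y
      rw [hF0, inner_zero_right, pd] at this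
      simp [this]
    have := is_const_of_fderiv_eq_zero (hd.norm_sq ℝ) h x 0
    exact (sq_eq_sq₀ (norm_nonneg _) (norm_nonneg _)).1 this

end
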